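/- Let ρ ∈ (1/2, 1/√2), λ = √(4ρ² − 1), δ ∈ (0, ρ/√2 − λ/2). The three-dimensional Lebesgue measure of the set Γ(ρ,δ) equals G(ρ,δ), where G(ρ,δ) = (λ + 2δ)·A(ρ) − (1/24)·[2δ(λ + 4δ) + (1 − √(1 − 4δ(λ + δ)))·(2 + 4δ(λ + δ) + 3λ²)] − (1/2)·ρ²·(λ + 2δ)·(arctan λ − arctan((λ + 2δ)/√(1 − 4δ(λ + δ)))) and A(ρ) = 1 − λ − ρ²·(π − 4·arctan λ). -/

import Mathlib

open MeasureTheory Real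

noncomputable def bpP (ρ α β u : ℝ) : ℝ :=
  α * u + β * u^2 / 2 - 2 * α * (u * √(ρ^2 - u^2) / 2 + ρ^2 / 2 * arctan (u / √(ρ^2 - u^2)))
    + 2 * β / 3 * √(ρ^2 - u^2) ^ 3

lemma bpP_deriv (ρ α β u : ℝ) (h : 0 < ρ^2 - u^2) :
    HasDerivAt (bpP ρ α β) ((1 - 2 * √(ρ^2 - u^2)) * (α + β * u)) u := by
  have hs : HasDerivAt (fun u : ℝ => √(ρ^2 - u^2)) (-(u / √(ρ^2 - u^2))) u := by
    have h1 : HasDerivAt (fun u : ℝ => ρ^2 - u^2) (-(2 * u)) u := by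
      have := (hasDerivAt_pow 2 u).const_sub (ρ^2)
      simpa using this
    have := h1.sqrt h.ne'
    convert this using 1
    field_simp
  have hpos : 0 < √(ρ^2 - u^2) := Real.sqrt_pos.mpr h
  have hsq : √(ρ^2 - u^2) ^ 2 = ρ^2 - u^2 := Real.sq_sqrt h.le
  have hid := hasDerivAt_id' u
  have hq := ((hid.div hs hpos.ne').arctan).const_mul (ρ^2/2)
  have hm := (hid.mul hs).div_const 2
  have hA := (hm.add hq).const_mul (2 * α)
  have hB := (hs.pow 3).const_mul (2 * β / 3)
  have hC := ((hasDerivAt_pow 2 u).const_mul β).div_const 2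
  have := (((hid.const_mul α).add hC).sub hA).add hB
  refine HasDerivAt.congr_deriv this ?_
  set s := √(ρ^2 - u^2) with hsdef
  have hr : ρ^2 = s^2 + u^2 := by linarith
  have h3 : (1 : ℝ) + (u / s)^2 = ρ^2 / s^2 := by rw [hr]; field_simp
  have h4 : ρ ≠ 0 := by rintro rfl; nlinarith
  have h5 : ρ^2 / 2 * (1 / (1 + (u / s)^2) * ((1 * s - u * -(u / s)) / s^2)) = ρ^2 / (2 * s) := by
    rw [h3]
    have : (1 * s - u * -(u / s)) = ρ^2 / s := by rw [hr]; field_simp; ring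
    rw [this]; field_simp
  simp only [Pi.div_apply]
  rw [h5, hr]
  norm_num
  field_simp
  ring

lemma bpP_int (ρ α β p q : ℝ) (hp : -ρ < p) (hpq : p ≤ q) (hq : q < ρ) :
    ∫ u in p..q, (1 - 2 * √(ρ^2 - u^2)) * (α + β * u) = bpP ρ α β q - bpP ρ α β p := by
  apply intervalIntegral.integral_eq_sub_of_hasDerivAt
  · intro u hu
    rw [Set.uIcc_of_le hpq] at hu
    apply bpP_deriv
    nlinarith [hu.1, hu.2]
  · apply Continuous.intervalIntegrable
    fun_prop

set_option maxHeartbeats 2000000 in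
lemma bp_slice (ρ l δ x : ℝ) (h1 : 1/2 < ρ) (hl0 : 0 < l) (hl1 : l < 1) (hl2 : l^2 = 4*ρ^2 - 1)
    (hδ0 : 0 < δ) (hx : |x| ≤ (1 - l)/2) :
    {p : ℝ × ℝ | |x| ≤ 1/2 ∧ |p.1| ≤ 1/2 ∧
        (∀ s ∈ ({-(1/2), 1/2} : Set ℝ), ∀ t ∈ ({-(1/2), 1/2} : Set ℝ),
          ρ^2 ≤ (x - s)^2 + (p.1 - t)^2) ∧
        (1 - l)/2 - δ ≤ p.2 ∧ p.2 ≤ (1 + l)/2 + δ ∧ x ≤ p.2} =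
    Set.Icc (-(1/2 - √(ρ^2 - (1/2 - |x|)^2))) (1/2 - √(ρ^2 - (1/2 - |x|)^2)) ×ˢ
      Set.Icc (max x ((1 - l)/2 - δ)) ((1 + l)/2 + δ) := by
  have hx0 := abs_nonneg x
  have hpos : 0 ≤ ρ^2 - (1/2 - |x|)^2 := by nlinarith
  set s := √(ρ^2 - (1/2 - |x|)^2) with hs
  have hs0 : 0 ≤ s := Real.sqrt_nonneg _
  have hsq : s^2 = ρ^2 - (1/2 - |x|)^2 := Real.sq_sqrt hpos
  ext ⟨y, z⟩
  simp only [Set.mem_ofPred_eq, Set.mem_prod, Set.mem_Icc, Set.mem_insert_iff,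
    Set.mem_singleton_iff, forall_eq_or_imp, forall_eq, max_le_iff]
  have key : ∀ {a b : ℝ}, |a| ≤ b ↔ -b ≤ a ∧ a ≤ b := abs_le
  rw [← @key y]
  have hy0 := abs_nonneg y
  have e1 : x^2 = |x|^2 := (sq_abs x).symm
  have e2 : y^2 = |y|^2 := (sq_abs y).symm
  constructor
  · rintro ⟨ha, hb, ⟨⟨c1, c2⟩, c3, c4⟩, d1, d2, d3⟩
    refine ⟨?_, ⟨d3, d1⟩, d2⟩
    have : s^2 ≤ (1/2 - |y|)^2 := by
      rcases abs_cases x with ⟨hx', _⟩ | ⟨hx', _⟩ <;> rcases abs_cases y with ⟨hy', _⟩ | ⟨hy', _⟩ <;>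
        rw [hsq, hx', hy'] <;> nlinarith
    have := abs_le_of_sq_le_sq this (by linarith)
    linarith [le_abs_self s]
  · rintro ⟨ha, ⟨d3, d1⟩, d2⟩
    have hb : |y| ≤ 1/2 := by linarith
    have : s^2 ≤ (1/2 - |y|)^2 := by nlinarith
    have a1 := le_abs_self x
    have a2 := neg_abs_le x
    have a3 := le_abs_self y
    have a4 := neg_abs_le y
    have b1 : (1/2 - |x|)^2 ≤ (x - 1/2)^2 := by linarith
    have b2 : (1/2 - |x|)^2 ≤ (x - -(1/2))^2 := by linarith
    have b3 : (1/2 - |y|)^2 ≤ (y - 1/2)^2 := by linarith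
    have b4 : (1/2 - |y|)^2 ≤ (y - -(1/2))^2 := by linarith
    refine ⟨by linarith, hb, ⟨⟨?_, ?_⟩, ?_, ?_⟩, d1, d2, d3⟩ <;> linarith

lemma bp_slice_empty (ρ l δ x : ℝ) (h1 : 1/2 < ρ) (hl0 : 0 < l) (hl1 : l < 1)
    (hl2 : l^2 = 4*ρ^2 - 1) (hx : ¬ |x| ≤ (1 - l)/2) :
    {p : ℝ × ℝ | |x| ≤ 1/2 ∧ |p.1| ≤ 1/2 ∧
        (∀ s ∈ ({-(1/2), 1/2} : Set ℝ), ∀ t ∈ ({-(1/2), 1/2} : Set ℝ),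
          ρ^2 ≤ (x - s)^2 + (p.1 - t)^2) ∧
        (1 - l)/2 - δ ≤ p.2 ∧ p.2 ≤ (1 + l)/2 + δ ∧ x ≤ p.2} = ∅ := by
  push Not at hx
  ext ⟨y, z⟩
  simp only [Set.mem_ofPred_eq, Set.mem_insert_iff, Set.mem_empty_iff_false, iff_false,
    Set.mem_singleton_iff, forall_eq_or_imp, forall_eq]
  rintro ⟨ha, hb, ⟨⟨c1, c2⟩, c3, c4⟩, d1, d2, d3⟩
  have hy0 := abs_nonneg y
  have : ρ^2 ≤ (1/2 - |x|)^2 + (1/2 - |y|)^2 := by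
      rcases abs_cases x with ⟨hx', _⟩ | ⟨hx', _⟩ <;> rcases abs_cases y with ⟨hy', _⟩ | ⟨hy', _⟩ <;>
        rw [hx', hy'] <;> nlinarith
  nlinarith

lemma bp_real (ρ l δ S : ℝ) (h1 : 1/2 < ρ) (hl0 : 0 < l) (hl1 : l < 1) (hl2 : l^2 = 4*ρ^2 - 1)
    (hδ0 : 0 < δ) (hm : l/2 + δ < 1/2) (hS0 : 0 < S) (hS : S^2 = 1 - 4*δ*(l+δ)) :
    ∫ x in (-((1-l)/2))..((1-l)/2), (1 - 2 * √(ρ^2 - (1/2 - |x|)^2)) *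
        ((1 + l)/2 + δ - max x ((1 - l)/2 - δ)) =
      (l + 2*δ) * (1 - l - ρ^2 * (Real.pi - 4 * Real.arctan l))
          - (1/24) * (2*δ*(l + 4*δ)
              + (1 - S) * (2 + 4*δ*(l + δ) + 3*l^2))
          - (1/2) * ρ^2 * (l + 2*δ)
              * (Real.arctan l - Real.arctan ((l + 2*δ)/S)) := by
  set f : ℝ → ℝ := fun x => (1 - 2 * √(ρ^2 - (1/2 - |x|)^2)) *
        ((1 + l)/2 + δ - max x ((1 - l)/2 - δ)) with hf
  have hc : Continuous f := by rw [hf]; fun_prop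
  have hi : ∀ a b, IntervalIntegrable f volume a b := fun a b => hc.intervalIntegrable a b
  rw [← intervalIntegral.integral_add_adjacent_intervals (hi _ 0) (hi 0 _),
    ← intervalIntegral.integral_add_adjacent_intervals (hi 0 ((1-l)/2 - δ)) (hi _ _)]
  have i1 : ∫ x in (-((1-l)/2))..0, f x = bpP ρ (l+2*δ) 0 (1/2) - bpP ρ (l+2*δ) 0 (l/2) := by
    rw [← bpP_int ρ _ _ (l/2) (1/2) (by linarith) (by linarith) (by linarith)]
    have := intervalIntegral.integral_comp_add_right (a := -((1-l)/2)) (b := 0)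
      (fun u => (1 - 2 * √(ρ^2 - u^2)) * ((l+2*δ) + 0 * u)) (1/2)
    rw [zero_add, show -((1-l)/2) + 1/2 = l/2 by ring] at this
    rw [← this]
    apply intervalIntegral.integral_congr
    intro x hx
    rw [Set.uIcc_of_le (by linarith)] at hx
    simp only [hf]
    rw [abs_of_nonpos hx.2, max_eq_right (by linarith [hx.2])]
    ring_nf
  have i2 : ∫ x in 0..((1-l)/2 - δ), f x
      = bpP ρ (l+2*δ) 0 (1/2) - bpP ρ (l+2*δ) 0 (l/2+δ) := by
    rw [← bpP_int ρ _ _ (l/2+δ) (1/2) (by linarith) (by linarith) (by linarith)]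
    have e1 : l/2 + δ = 1/2 - ((1-l)/2 - δ) := by ring
    have e2 : (1/2:ℝ) = 1/2 - 0 := by ring
    rw [e1]
    have := intervalIntegral.integral_comp_sub_left (a := 0) (b := (1-l)/2 - δ)
      (fun u => (1 - 2 * √(ρ^2 - u^2)) * ((l+2*δ) + 0 * u)) (1/2)
    rw [sub_zero] at this
    rw [← this]
    apply intervalIntegral.integral_congr
    intro x hx
    rw [Set.uIcc_of_le (by linarith)] at hx
    simp only [hf]
    rw [abs_of_nonneg hx.1, max_eq_right hx.2]
    ring_nf
  have i3 : ∫ x in ((1-l)/2 - δ)..((1-l)/2), f x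
      = bpP ρ (l/2+δ) 1 (l/2+δ) - bpP ρ (l/2+δ) 1 (l/2) := by
    rw [← bpP_int ρ _ _ (l/2) (l/2+δ) (by linarith) (by linarith) (by linarith)]
    have := intervalIntegral.integral_comp_sub_left (a := (1-l)/2 - δ) (b := (1-l)/2)
      (fun u => (1 - 2 * √(ρ^2 - u^2)) * ((l/2+δ) + 1 * u)) (1/2)
    rw [show 1/2 - (1-l)/2 = l/2 by ring, show 1/2 - ((1-l)/2 - δ) = l/2 + δ by ring] at this
    rw [← this]
    apply intervalIntegral.integral_congr
    intro x hx
    rw [Set.uIcc_of_le (by linarith)] at hx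
    simp only [hf]
    rw [abs_of_nonneg (by linarith [hx.1]), max_eq_left hx.1]
    ring_nf
  rw [i1, i2, i3]
  have s1 : √(ρ^2 - (1/2)^2) = l/2 := by
    rw [show ρ^2 - (1/2)^2 = (l/2)^2 by linarith]; exact Real.sqrt_sq (by linarith)
  have s2 : √(ρ^2 - (l/2)^2) = 1/2 := by
    rw [show ρ^2 - (l/2)^2 = (1/2)^2 by linarith]; exact Real.sqrt_sq (by linarith)
  have s3 : √(ρ^2 - (l/2+δ)^2) = S/2 := by
    rw [show ρ^2 - (l/2+δ)^2 = (S/2)^2 by linarith]; exact Real.sqrt_sq (by linarith)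
  simp only [bpP, s1, s2, s3]
  rw [show (1/2 / (l/2) : ℝ) = l⁻¹ by field_simp, show (l/2/(1/2) : ℝ) = l by field_simp,
    show (l/2+δ)/(S/2) = (l+2*δ)/S by field_simp, Real.arctan_inv_of_pos hl0]
  have hr : ρ^2 = (l^2+1)/4 := by linarith
  have hS3 : S^3 = S * (1 - 4*δ*(l+δ)) := by rw [← hS]; ring
  rw [div_pow S, hS3, hr]
  generalize arctan ((l+2*δ)/S) = A
  generalize arctan l = B
  ring

lemma bp_lint (ρ l δ : ℝ) (h1 : 1/2 < ρ) (hl0 : 0 < l) (hl1 : l < 1) (hl2 : l^2 = 4*ρ^2 - 1)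
    (hδ0 : 0 < δ) :
    volume {q : EuclideanSpace ℝ (Fin 3) |
        |q 0| ≤ 1/2 ∧ |q 1| ≤ 1/2 ∧
        (∀ s ∈ ({-(1/2), 1/2} : Set ℝ), ∀ t ∈ ({-(1/2), 1/2} : Set ℝ),
          ρ^2 ≤ (q 0 - s)^2 + (q 1 - t)^2) ∧
        (1 - l)/2 - δ ≤ q 2 ∧ q 2 ≤ (1 + l)/2 + δ ∧ q 0 ≤ q 2} =
    ENNReal.ofReal (∫ x in (-((1-l)/2))..((1-l)/2), (1 - 2 * √(ρ^2 - (1/2 - |x|)^2)) *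
        ((1 + l)/2 + δ - max x ((1 - l)/2 - δ))) := by
  set T : Set (ℝ × (ℝ × ℝ)) := {p | |p.1| ≤ 1/2 ∧ |p.2.1| ≤ 1/2 ∧
        (∀ s ∈ ({-(1/2), 1/2} : Set ℝ), ∀ t ∈ ({-(1/2), 1/2} : Set ℝ),
          ρ^2 ≤ (p.1 - s)^2 + (p.2.1 - t)^2) ∧
        (1 - l)/2 - δ ≤ p.2.2 ∧ p.2.2 ≤ (1 + l)/2 + δ ∧ p.1 ≤ p.2.2} with hT
  have hTm : MeasurableSet T := by
    apply IsClosed.measurableSet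
    rw [hT]
    simp only [Set.mem_insert_iff, Set.mem_singleton_iff, forall_eq_or_imp, forall_eq]
    repeat' apply IsClosed.and
    all_goals exact isClosed_le (by fun_prop) (by fun_prop)
  have mp : MeasurePreserving (fun q : EuclideanSpace ℝ (Fin 3) => (q 0, (q 1, q 2)))
      volume volume := by
    have m1 := EuclideanSpace.volume_preserving_symm_measurableEquiv_toLp (Fin 3)
    have m2 := volume_preserving_piFinSuccAbove (fun _ : Fin 3 => ℝ) 0
    have m3 := volume_preserving_finTwoArrow ℝ
    have m4 := (MeasurePreserving.id (volume : Measure ℝ)).prod m3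
    exact m4.comp (m2.comp m1)
  have : volume T = ENNReal.ofReal (∫ x in (-((1-l)/2))..((1-l)/2),
      (1 - 2 * √(ρ^2 - (1/2 - |x|)^2)) * ((1 + l)/2 + δ - max x ((1 - l)/2 - δ))) := by
    rw [Measure.volume_eq_prod, Measure.prod_apply hTm]
    have hsl : ∀ x : ℝ, volume (Prod.mk x ⁻¹' T) =
        (Set.Icc (-((1-l)/2)) ((1-l)/2)).indicator (fun x => ENNReal.ofReal
        ((1 - 2 * √(ρ^2 - (1/2 - |x|)^2)) * ((1 + l)/2 + δ - max x ((1 - l)/2 - δ)))) x := by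
      intro x
      by_cases hx : |x| ≤ (1-l)/2
      · rw [Set.indicator_of_mem (Set.mem_Icc.mpr (abs_le.mp hx))]
        have := bp_slice ρ l δ x h1 hl0 hl1 hl2 hδ0 hx
        have e : Prod.mk x ⁻¹' T = _ := this
        rw [e, Measure.volume_eq_prod, Measure.prod_prod, Real.volume_Icc, Real.volume_Icc,
          ← ENNReal.ofReal_mul']
        · congr 1; ring
        · have : max x ((1 - l)/2 - δ) ≤ (1-l)/2 := 
            max_le (le_trans (le_abs_self x) hx) (by linarith)
          linarith
      · rw [Set.indicator_of_notMem (fun h => hx (abs_le.mpr (Set.mem_Icc.mp h)))]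
        have e : Prod.mk x ⁻¹' T = _ := bp_slice_empty ρ l δ x h1 hl0 hl1 hl2 hx
        rw [e, measure_empty]
    simp_rw [hsl]
    rw [lintegral_indicator measurableSet_Icc, intervalIntegral.integral_of_le (by linarith),
      ← integral_Icc_eq_integral_Ioc, ofReal_integral_eq_lintegral_ofReal]
    · apply Continuous.integrableOn_Icc
      fun_prop
    · rw [Filter.EventuallyLE, ae_restrict_iff' measurableSet_Icc]
      refine Filter.Eventually.of_forall fun x hx => ?_
      have hx' : |x| ≤ (1-l)/2 := abs_le.mpr hx
      have : max x ((1 - l)/2 - δ) ≤ (1-l)/2 := 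
            max_le (le_trans (le_abs_self x) hx') (by linarith)
      have h3 : √(ρ^2 - (1/2 - |x|)^2) ≤ 1/2 := by
        apply Real.sqrt_le_iff.mpr ⟨by norm_num, ?_⟩
        nlinarith
      exact mul_nonneg (by linarith) (by linarith)
  rw [← this, ← mp.measure_preimage hTm.nullMeasurableSet]
  rfl


/-- The volume of the configuration space `Γ(ρ,δ)` of the minimal ball-piston model. -/
theorem stmt_2 (ρ l δ : ℝ) (h1 : 1/2 < ρ) (h2 : ρ < 1/Real.sqrt 2)
    (hl : l = Real.sqrt (4*ρ^2 - 1))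
    (hδ0 : 0 < δ) (hδ : δ < ρ/Real.sqrt 2 - l/2) :
    volume {q : EuclideanSpace ℝ (Fin 3) |
        |q 0| ≤ 1/2 ∧ |q 1| ≤ 1/2 ∧
        (∀ s ∈ ({-(1/2), 1/2} : Set ℝ), ∀ t ∈ ({-(1/2), 1/2} : Set ℝ),
          ρ^2 ≤ (q 0 - s)^2 + (q 1 - t)^2) ∧
        (1 - l)/2 - δ ≤ q 2 ∧ q 2 ≤ (1 + l)/2 + δ ∧ q 0 ≤ q 2} =
      ENNReal.ofReal
        ((l + 2*δ) * (1 - l - ρ^2 * (Real.pi - 4 * Real.arctan l))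
          - (1/24) * (2*δ*(l + 4*δ)
              + (1 - Real.sqrt (1 - 4*δ*(l + δ))) * (2 + 4*δ*(l + δ) + 3*l^2))
          - (1/2) * ρ^2 * (l + 2*δ)
              * (Real.arctan l
                  - Real.arctan ((l + 2*δ)/Real.sqrt (1 - 4*δ*(l + δ))))) := by
  have hs2 : (0:ℝ) < √2 := by positivity
  have hs22 : √2^2 = (2:ℝ) := Real.sq_sqrt (by norm_num)
  have hr2 : ρ * √2 < 1 := by rwa [lt_div_iff₀ hs2] at h2
  have hr3 : ρ^2 * 2 < 1 := by
    have : ρ^2 * 2 = (ρ * √2)^2 := by rw [mul_pow, hs22]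
    rw [this]; nlinarith [mul_pos (by linarith : 0 < ρ) hs2]
  have hl0 : 0 < l := by rw [hl]; apply Real.sqrt_pos.mpr; nlinarith
  have hl2 : l^2 = 4*ρ^2 - 1 := by rw [hl]; apply Real.sq_sqrt; nlinarith
  have hl1 : l < 1 := by nlinarith
  have hm : l/2 + δ < 1/2 := by
    have : ρ/√2 = ρ * √2 / 2 := by rw [div_eq_div_iff hs2.ne' (by norm_num)]; linear_combination -ρ * hs22
    linarith
  have hSp : 0 < 1 - 4*δ*(l+δ) := by nlinarith
  rw [bp_lint ρ l δ h1 hl0 hl1 hl2 hδ0, bp_real ρ l δ (√(1 - 4*δ*(l+δ))) h1 hl0 hl1 hl2 hδ0 hm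
    (Real.sqrt_pos.mpr hSp) (Real.sq_sqrt hSp.le)]
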